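/- arXiv:1612.02663 — 3 statements merged into one kernel-verified Lean document; each statement's English description precedes it below -/
import Mathlib

section
/- Let r and n be positive integers and let H_1 and H_2 be r-uniform hypergraphs with vertex sets V_1 and V_2 of cardinality at most n, having m_1 and m_2 edges respectively. Suppose each edge of H_i intersects at most d_i other edges of H_i (for i = 1, 2), and suppose (d_1 + 1)·m_2 + (d_2 + 1)·m_1 < C(n,r)/e, where C(n,r) is the binomial coefficient and e is the base of the natural logarithm. Then there exist injections φ_1 : V_1 → [n] and φ_2 : V_2 → [n] such that φ_1(H_1) and φ_2(H_2) are edge-disjoint: there are no edges e_1 ∈ H_1 and e_2 ∈ H_2 with {φ_1(v) : v ∈ e_1} = {φ_2(v) : v ∈ e_2}. -/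
open Finset in
/-- Symmetric lopsided Lovász local lemma, in counting form: `Γ i` contains the events that
may be positively correlated with `A i`. -/
theorem exists_forall_notMem_of_lopsided {Ω ι : Type*} [Fintype Ω] [Nonempty Ω] [DecidableEq Ω]
    [DecidableEq ι] (A : ι → Finset Ω) (Γ : ι → Finset ι) (I : Finset ι) (p : ℝ) (k : ℕ)
    (hk : 0 < k) (hp : p * (Real.exp 1 * (k + 1)) ≤ 1)
    (hΓ : ∀ i ∈ I, ((Γ i).erase i).card ≤ k)
    (hneg : ∀ i ∈ I, ∀ S ⊆ I, (∀ j ∈ S, j ∉ Γ i) →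
      ((A i ∩ (S.biUnion A)ᶜ).card : ℝ) ≤ p * ((S.biUnion A)ᶜ.card : ℝ)) :
    ∃ ω, ∀ i ∈ I, ω ∉ A i := by
  have hk' : (0 : ℝ) < k := by exact_mod_cast hk
  set x : ℝ := 1 / (k + 1) with hx
  have hx0 : 0 < x := by positivity
  have hx1 : 1 - x = k / (k + 1) := by rw [hx]; field_simp; ring
  have hc0 : 0 < 1 - x := by rw [hx1]; positivity
  have hcle : 1 - x ≤ 1 := by linarith
  have hpx : p ≤ x * (1 - x) ^ k := by
    have h1 : ((k + 1 : ℝ) / k) ^ k ≤ Real.exp 1 := by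
      have h2 : (k + 1 : ℝ) / k ≤ Real.exp (1 / k) := by
        have := Real.add_one_le_exp (1 / k : ℝ)
        have h3 : (k + 1 : ℝ) / k = 1 / k + 1 := by field_simp; ring
        rwa [h3]
      calc ((k + 1 : ℝ) / k) ^ k ≤ (Real.exp (1 / k)) ^ k := by gcongr
        _ = Real.exp 1 := by
          rw [← Real.exp_nat_mul]
          congr 1
          field_simp
    have h4 : (1 - x) ^ k * ((k + 1 : ℝ) / k) ^ k = 1 := by
      rw [← mul_pow, hx1]
      have : (k : ℝ) / (k + 1) * ((k + 1) / k) = 1 := by field_simp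
      rw [this, one_pow]
    have h5 : 1 ≤ (1 - x) ^ k * Real.exp 1 := by
      exact h4.symm.le.trans (by gcongr)
    have h6 : p * Real.exp 1 ≤ x := by
      rw [hx, le_div_iff₀ (by positivity)]; linarith
    have h7 : (0 : ℝ) < Real.exp 1 := Real.exp_pos 1
    have h8 : p * Real.exp 1 ≤ (x * (1 - x) ^ k) * Real.exp 1 := by nlinarith
    exact le_of_mul_le_mul_right h8 h7
  have hins : ∀ (S : Finset ι) (j : ι),
      ((A j ∩ (S.biUnion A)ᶜ).card : ℝ) ≤ x * ((S.biUnion A)ᶜ.card : ℝ) →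
      (1 - x) * ((S.biUnion A)ᶜ.card : ℝ) ≤ (((insert j S).biUnion A)ᶜ.card : ℝ) := by
    intro S j h
    have h1 : ((insert j S).biUnion A)ᶜ = (S.biUnion A)ᶜ \ A j := by
      ext ω; simp [and_comm]
    have h2 : ((S.biUnion A)ᶜ \ A j).card + (A j ∩ (S.biUnion A)ᶜ).card = (S.biUnion A)ᶜ.card := by
      rw [inter_comm]; exact card_sdiff_add_card_inter _ _
    have h3 : (((S.biUnion A)ᶜ \ A j).card : ℝ) + (A j ∩ (S.biUnion A)ᶜ).card
      = (S.biUnion A)ᶜ.card := by exact_mod_cast h2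
    rw [h1]; linarith
  have hmain : ∀ S ⊆ I, ∀ i ∈ I,
      ((A i ∩ (S.biUnion A)ᶜ).card : ℝ) ≤ x * ((S.biUnion A)ᶜ.card : ℝ) := by
    intro S
    induction S using Finset.strongInduction with
    | H S ih =>
      intro hS i hi
      by_cases hiS : i ∈ S
      · have : A i ∩ (S.biUnion A)ᶜ = ∅ := by
          ext ω
          simp only [mem_inter, mem_compl, mem_biUnion, notMem_empty, iff_false]
          exact fun h => h.2 ⟨i, hiS, h.1⟩
        rw [this, card_empty, Nat.cast_zero]
        positivity
      set T := S.filter (· ∉ Γ i)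
      set R := S.filter (· ∈ Γ i)
      have hTS : T ⊆ S := filter_subset _ _
      have hchain : ∀ U ⊆ R,
          (1 - x) ^ U.card * ((T.biUnion A)ᶜ.card : ℝ) ≤ (((U ∪ T).biUnion A)ᶜ.card : ℝ) := by
        intro U
        induction U using Finset.induction_on with
        | empty => intro _; simp
        | insert u U hu ihU =>
          intro hUR
          have huR : u ∈ R := hUR (mem_insert_self _ _)
          have hUR' : U ⊆ R := (subset_insert _ _).trans hUR
          have huS : u ∈ S := (mem_filter.1 huR).1
          have hsub : U ∪ T ⊂ S := by
            refine (ssubset_iff_of_subset (union_subset (hUR'.trans (filter_subset _ _)) hTS)).2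
              ⟨u, huS, ?_⟩
            rw [mem_union, not_or]
            exact ⟨hu, fun h => (mem_filter.1 h).2 (mem_filter.1 huR).2⟩
          have := hins (U ∪ T) u (ih _ hsub (hsub.1.trans hS) u (hS huS))
          rw [card_insert_of_notMem hu, insert_union, pow_succ']
          calc _ = (1 - x) * ((1 - x) ^ U.card * ((T.biUnion A)ᶜ.card : ℝ)) := by ring
            _ ≤ (1 - x) * (((U ∪ T).biUnion A)ᶜ.card : ℝ) := by
              gcongr; exact ihU hUR'
            _ ≤ _ := this
      have hRT : R ∪ T = S := filter_union_filter_not_eq _ _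
      have hR : R.card ≤ k := by
        refine (card_le_card fun j hj => ?_).trans (hΓ i hi)
        rw [mem_filter] at hj
        exact mem_erase.2 ⟨fun h => hiS (h ▸ hj.1), hj.2⟩
      have h1 := hchain R subset_rfl
      rw [hRT] at h1
      calc ((A i ∩ (S.biUnion A)ᶜ).card : ℝ) ≤ ((A i ∩ (T.biUnion A)ᶜ).card : ℝ) := by
            gcongr
        _ ≤ p * ((T.biUnion A)ᶜ.card : ℝ) :=
            hneg i hi T (hTS.trans hS) fun j hj => (mem_filter.1 hj).2
        _ ≤ (x * (1 - x) ^ k) * ((T.biUnion A)ᶜ.card : ℝ) := by gcongr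
        _ ≤ (x * (1 - x) ^ R.card) * ((T.biUnion A)ᶜ.card : ℝ) := by
            gcongr x * ?_ * _
            exact pow_le_pow_of_le_one hc0.le hcle hR
        _ = x * ((1 - x) ^ R.card * ((T.biUnion A)ᶜ.card : ℝ)) := by ring
        _ ≤ _ := by gcongr
  have hpos : ∀ S ⊆ I, (0 : ℝ) < ((S.biUnion A)ᶜ.card : ℝ) := by
    intro S
    induction S using Finset.induction_on with
    | empty => intro _; simpa using Fintype.card_pos
    | insert j S hj ih =>
      intro hS
      have hS' := (subset_insert j S).trans hS
      exact (mul_pos hc0 (ih hS')).trans_le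
        (hins S j (hmain S hS' j (hS (mem_insert_self _ _))))
  have h := hpos I subset_rfl
  obtain ⟨ω, hω⟩ := card_pos.1 (Nat.cast_pos.1 h)
  refine ⟨ω, fun i hi hA => ?_⟩
  rw [mem_compl, mem_biUnion] at hω
  exact hω ⟨i, hi, hA⟩

open Finset in
theorem Finset.exists_perm_image_eq_of_card_eq {α : Type*} [Fintype α] [DecidableEq α]
    {s t : Finset α} (h : s.card = t.card) :
    ∃ π : Equiv.Perm α, s.image π = t ∧ ∀ x, x ∉ s → x ∉ t → π x = x := by
  have hc : (s.subtype (· ∈ s ∪ t)).card = (t.subtype (· ∈ s ∪ t)).card := by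
    rw [card_subtype, card_subtype, filter_true_of_mem, filter_true_of_mem, h]
    · exact fun x hx => mem_union_right _ hx
    · exact fun x hx => mem_union_left _ hx
  let f := Finset.equivOfCardEq hc
  refine ⟨Equiv.Perm.ofSubtype (f.extendSubtype), ?_, fun x hs ht => ?_⟩
  · refine eq_of_subset_of_card_le ?_ ?_
    · intro y hy
      obtain ⟨x, hx, rfl⟩ := mem_image.1 hy
      have hxu : x ∈ s ∪ t := mem_union_left _ hx
      rw [Equiv.Perm.ofSubtype_apply_of_mem _ hxu]
      have := Equiv.extendSubtype_mem f ⟨x, hxu⟩ (mem_subtype.2 hx)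
      exact mem_subtype.1 this
    · rw [card_image_of_injective _ (Equiv.injective _), h]
  · exact Equiv.Perm.ofSubtype_apply_of_not_mem _ (by simp [hs, ht])

open Finset in
/-- The events `σ(b) = a` for a uniformly random permutation `σ` are negatively correlated with
the avoidance of any family of such events supported on disjoint sets. -/
theorem choose_mul_card_perm_image_eq_le {α : Type*} [Fintype α] [DecidableEq α]
    {a b : Finset α} (hab : a.card = b.card) (F : Finset (Finset α × Finset α))
    (hF : ∀ f ∈ F, Disjoint f.1 a ∧ Disjoint f.2 b) :
    (Fintype.card α).choose b.card *
      (univ.filter fun σ : Equiv.Perm α => b.image σ = a ∧ ∀ f ∈ F, f.2.image σ ≠ f.1).card ≤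
    (univ.filter fun σ : Equiv.Perm α => ∀ f ∈ F, f.2.image σ ≠ f.1).card := by
  rw [card_eq_sum_card_fiberwise (f := fun σ : Equiv.Perm α => b.image σ)
    (s := univ.filter fun σ : Equiv.Perm α => ∀ f ∈ F, f.2.image σ ≠ f.1)
    (t := powersetCard b.card univ)]
  swap
  · intro σ _
    simp [mem_powersetCard, card_image_of_injective _ σ.injective]
  rw [← card_univ, ← card_powersetCard, ← smul_eq_mul]
  refine card_nsmul_le_sum _ _ _ fun c hc => ?_
  rw [mem_powersetCard_univ] at hc
  obtain ⟨π, hπ, hfix⟩ := exists_perm_image_eq_of_card_eq (hab.trans hc.symm)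
  refine card_le_card_of_injOn (fun σ => π * σ) (fun σ hσ => ?_)
    (fun σ _ τ _ h => mul_left_cancel h)
  simp only [coe_filter, mem_univ, true_and, Set.mem_ofPred_eq, mem_filter] at hσ ⊢
  obtain ⟨hσb, hσ⟩ := hσ
  have himg : ∀ s : Finset α, s.image (π * σ) = (s.image σ).image π := by
    intro s; rw [image_image, Equiv.Perm.coe_mul]
  refine ⟨fun f hf h => hσ f hf ?_, by rw [himg, hσb, hπ]⟩
  obtain ⟨h1, h2⟩ := hF f hf
  rw [himg] at h
  have h3 : Disjoint f.1 c := by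
    rw [← h, ← hπ, disjoint_image π.injective, ← hσb, disjoint_image σ.injective]
    exact h2
  have h4 : f.1.image π = f.1 := by
    conv_rhs => rw [← image_id (s := f.1)]
    exact image_congr fun x hx =>
      hfix x (disjoint_left.1 h1 hx) (disjoint_left.1 h3 hx)
  exact image_injective π.injective (h.trans h4.symm)

open Finset in
theorem card_filter_inter_nonempty_le {V : Type*} [DecidableEq V] {H : Finset (Finset V)} {d : ℕ}
    {e : Finset V}
    (hd : (H.filter (fun e' => e' ≠ e ∧ (e' ∩ e).Nonempty)).card ≤ d) :
    (H.filter (fun e' => (e' ∩ e).Nonempty)).card ≤ d + 1 := by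
  refine (card_le_card (t := insert e (H.filter (fun e' => e' ≠ e ∧ (e' ∩ e).Nonempty)))
    fun f hf => ?_).trans ((card_insert_le _ _).trans (Nat.succ_le_succ hd))
  simp only [mem_filter, mem_insert] at hf ⊢
  tauto

/-- Hypergraph packing: if `H₁, H₂` are `r`-uniform hypergraphs with `m₁, m₂` edges,
each edge of `Hᵢ` intersects at most `dᵢ` other edges of `Hᵢ`, and
`(d₁+1)·m₂ + (d₂+1)·m₁ < C(n,r)/e`, then there are injections `φᵢ : Vᵢ → [n]` such
that `φ₁(H₁)` and `φ₂(H₂)` are edge-disjoint. -/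
theorem hypergraph_packing (r n : ℕ) (hr : 0 < r) (hn : 0 < n)
    (V₁ V₂ : Type*) [Fintype V₁] [Fintype V₂] [DecidableEq V₁] [DecidableEq V₂]
    (hV₁ : Fintype.card V₁ ≤ n) (hV₂ : Fintype.card V₂ ≤ n)
    (H₁ : Finset (Finset V₁)) (H₂ : Finset (Finset V₂))
    (hu₁ : ∀ e ∈ H₁, e.card = r) (hu₂ : ∀ e ∈ H₂, e.card = r)
    (d₁ d₂ : ℕ)
    (hd₁ : ∀ e ∈ H₁, (H₁.filter (fun e' => e' ≠ e ∧ (e' ∩ e).Nonempty)).card ≤ d₁)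
    (hd₂ : ∀ e ∈ H₂, (H₂.filter (fun e' => e' ≠ e ∧ (e' ∩ e).Nonempty)).card ≤ d₂)
    (hcrit : ((d₁ + 1) * H₂.card + (d₂ + 1) * H₁.card : ℝ) < (n.choose r : ℝ) / Real.exp 1) :
    ∃ (φ₁ : V₁ ↪ Fin n) (φ₂ : V₂ ↪ Fin n),
      ∀ e₁ ∈ H₁, ∀ e₂ ∈ H₂, e₁.image φ₁ ≠ e₂.image φ₂ := by
  classical
  obtain ⟨ι₁⟩ : Nonempty (V₁ ↪ Fin n) :=
    Function.Embedding.nonempty_of_card_le (by simpa using hV₁)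
  obtain ⟨ι₂⟩ : Nonempty (V₂ ↪ Fin n) :=
    Function.Embedding.nonempty_of_card_le (by simpa using hV₂)
  rcases H₁.eq_empty_or_nonempty with rfl | hne₁
  · exact ⟨ι₁, ι₂, by simp⟩
  rcases H₂.eq_empty_or_nonempty with rfl | hne₂
  · exact ⟨ι₁, ι₂, by simp⟩
  have hm₁ : 0 < H₁.card := hne₁.card_pos
  have hm₂ : 0 < H₂.card := hne₂.card_pos
  obtain ⟨k, hk⟩ : ∃ k, (d₁ + 1) * H₂.card + (d₂ + 1) * H₁.card = k + 1 :=
    Nat.exists_eq_add_one.2 (by positivity)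
  have hk0 : 0 < k := by nlinarith [Nat.zero_le (d₁ * H₂.card), Nat.zero_le (d₂ * H₁.card)]
  have hkR : ((d₁ + 1) * H₂.card + (d₂ + 1) * H₁.card : ℝ) = k + 1 := by exact_mod_cast hk
  rw [hkR, lt_div_iff₀ (Real.exp_pos 1)] at hcrit
  have hC : (0 : ℝ) < n.choose r := lt_of_le_of_lt (by positivity) hcrit
  let A : Finset V₁ × Finset V₂ → Finset (Equiv.Perm (Fin n)) := fun q =>
    Finset.univ.filter fun σ => (q.2.image ι₂).image σ = q.1.image ι₁
  let Γ : Finset V₁ × Finset V₂ → Finset (Finset V₁ × Finset V₂) := fun q =>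
    (H₁.filter fun e => (e ∩ q.1).Nonempty) ×ˢ H₂ ∪ H₁ ×ˢ H₂.filter fun e => (e ∩ q.2).Nonempty
  have hlll := exists_forall_notMem_of_lopsided A Γ (H₁ ×ˢ H₂) (1 / n.choose r) k hk0
    (by rw [one_div, inv_mul_le_iff₀ hC]; linarith) ?_ ?_
  · obtain ⟨σ, hσ⟩ := hlll
    refine ⟨ι₁, ι₂.trans σ.toEmbedding, fun e₁ he₁ e₂ he₂ h => ?_⟩
    refine hσ (e₁, e₂) (Finset.mk_mem_product he₁ he₂) ?_
    simp only [A, Finset.mem_filter, Finset.mem_univ, true_and]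
    rw [h, Finset.image_image]
    rfl
  · rintro ⟨e₁, e₂⟩ he
    obtain ⟨he₁, he₂⟩ := Finset.mem_product.1 he
    have hself : (e₁, e₂) ∈ Γ (e₁, e₂) := by
      have : (e₁ ∩ e₁).Nonempty := by
        rw [Finset.inter_self, ← Finset.card_pos, hu₁ e₁ he₁]; exact hr
      exact Finset.mem_union_left _
        (Finset.mk_mem_product (Finset.mem_filter.2 ⟨he₁, this⟩) he₂)
    rw [Finset.card_erase_of_mem hself, Nat.sub_le_iff_le_add, ← hk]
    refine (Finset.card_union_le _ _).trans ?_
    rw [Finset.card_product, Finset.card_product, mul_comm H₁.card]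
    gcongr
    · exact card_filter_inter_nonempty_le (hd₁ e₁ he₁)
    · exact card_filter_inter_nonempty_le (hd₂ e₂ he₂)
  · rintro ⟨e₁, e₂⟩ he S hS hSΓ
    obtain ⟨he₁, he₂⟩ := Finset.mem_product.1 he
    have hc₁ : (e₁.image ι₁).card = r := by
      rw [Finset.card_image_of_injective _ ι₁.injective, hu₁ e₁ he₁]
    have hc₂ : (e₂.image ι₂).card = r := by
      rw [Finset.card_image_of_injective _ ι₂.injective, hu₂ e₂ he₂]
    have key := choose_mul_card_perm_image_eq_le (hc₁.trans hc₂.symm)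
      (S.image fun q => (q.1.image ι₁, q.2.image ι₂)) ?_
    · rw [hc₂, Fintype.card_fin] at key
      rw [one_div, inv_mul_eq_div, le_div_iff₀' hC]
      have h1 : A (e₁, e₂) ∩ (S.biUnion A)ᶜ = Finset.univ.filter fun σ : Equiv.Perm (Fin n) =>
          (e₂.image ι₂).image σ = e₁.image ι₁ ∧
          ∀ f ∈ S.image fun q => (q.1.image ι₁, q.2.image ι₂), f.2.image σ ≠ f.1 := by
        ext σ
        simp only [A, Finset.mem_inter, Finset.mem_filter, Finset.mem_univ, true_and,
          Finset.mem_compl, Finset.mem_biUnion, Finset.forall_mem_image, not_exists, not_and,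
          ne_eq]
      have h2 : (S.biUnion A)ᶜ = Finset.univ.filter fun σ : Equiv.Perm (Fin n) =>
          ∀ f ∈ S.image fun q => (q.1.image ι₁, q.2.image ι₂), f.2.image σ ≠ f.1 := by
        ext σ
        simp only [A, Finset.mem_filter, Finset.mem_univ, true_and,
          Finset.mem_compl, Finset.mem_biUnion, Finset.forall_mem_image, not_exists, not_and,
          ne_eq]
      rw [h1, h2]
      exact_mod_cast key
    · rw [Finset.forall_mem_image]
      intro q hq
      obtain ⟨hq₁, hq₂⟩ := Finset.mem_product.1 (hS hq)
      have hqΓ := hSΓ q hq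
      simp only [Γ, Finset.mem_union, Finset.mem_product, Finset.mem_filter, hq₁, hq₂, true_and,
        and_true, not_or, Finset.not_nonempty_iff_eq_empty] at hqΓ
      rw [Finset.disjoint_image ι₁.injective, Finset.disjoint_image ι₂.injective,
        Finset.disjoint_iff_inter_eq_empty, Finset.disjoint_iff_inter_eq_empty]
      exact hqΓ
end

section
/- Let n ≥ 1, let π be a permutation of [n], let x_1, …, x_r ∈ [n] be distinct, and let σ, τ be permutations of [n]. Then P(Swap(π; x_1, …, x_r) = σ) = P(Swap(π∘τ; τ⁻¹(x_1), …, τ⁻¹(x_r)) = σ∘τ), and also P(Swap(π; x_1, …, x_r) = σ) = P(Swap(τ∘π; x_1, …, x_r) = τ∘σ). Here composition is written so that (σ∘τ)(x) = σ(τ(x)). -/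
open scoped Classical

/-- The result of the swapping subroutine `Swap(π; x_1, …, x_r)` when the random
choices are `c_1, …, c_r`: for `i = 1, …, r` in order, `π` is replaced by
`π ∘ (x_i c_i)`. -/
noncomputable def swapResult {n r : ℕ} (π : Equiv.Perm (Fin n)) (x c : Fin r → Fin n) :
    Equiv.Perm (Fin n) :=
  (List.ofFn fun i => Equiv.swap (x i) (c i)).foldl (· * ·) π

/-- The set of valid random choices of the swapping subroutine: the `i`-th choice
`c i` is drawn uniformly from `[n] ∖ {x_1, …, x_{i-1}}`.  All valid choice tuples
are equally likely. -/
noncomputable def swapChoices (n r : ℕ) (x : Fin r → Fin n) : Finset (Fin r → Fin n) :=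
  Finset.univ.filter fun c => ∀ i j : Fin r, j < i → c i ≠ x j

/-- `P(Swap(π; x_1, …, x_r) = σ)`: since every valid tuple of random choices is
equally likely, this is the fraction of valid choice tuples producing `σ`. -/
noncomputable def swapProb {n r : ℕ} (π : Equiv.Perm (Fin n)) (x : Fin r → Fin n)
    (σ : Equiv.Perm (Fin n)) : ℝ :=
  (((swapChoices n r x).filter fun c => swapResult π x c = σ).card : ℝ) /
    ((swapChoices n r x).card : ℝ)

theorem swapResult_eq_mul_prod {n r : ℕ} (π : Equiv.Perm (Fin n)) (x c : Fin r → Fin n) :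
    swapResult π x c = π * (List.ofFn fun i => Equiv.swap (x i) (c i)).prod := by
  unfold swapResult
  generalize (List.ofFn fun i => Equiv.swap (x i) (c i)) = l
  induction l generalizing π with
  | nil => simp
  | cons a l ih => rw [List.foldl_cons, ih, List.prod_cons, mul_assoc]

theorem swapResult_mul_left {n r : ℕ} (τ π : Equiv.Perm (Fin n)) (x c : Fin r → Fin n) :
    swapResult (τ * π) x c = τ * swapResult π x c := by
  simp only [swapResult_eq_mul_prod, mul_assoc]

theorem swapResult_mul_right {n r : ℕ} (π τ : Equiv.Perm (Fin n)) (x c : Fin r → Fin n) :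
    swapResult (π * τ) (fun i => τ⁻¹ (x i)) (fun i => τ⁻¹ (c i)) = swapResult π x c * τ := by
  have h : (List.ofFn fun i => Equiv.swap (τ⁻¹ (x i)) (τ⁻¹ (c i))) =
      (List.ofFn fun i => Equiv.swap (x i) (c i)).map (MulAut.conj τ⁻¹) := by
    rw [List.map_ofFn]
    congr 1
    funext i
    exact Equiv.swap_apply_apply τ⁻¹ (x i) (c i)
  rw [swapResult_eq_mul_prod, swapResult_eq_mul_prod, h, ← map_list_prod, MulAut.conj_apply]
  group

theorem mem_swapChoices_comp_iff {n r : ℕ} (τ : Equiv.Perm (Fin n)) (x c : Fin r → Fin n) :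
    (fun i => τ⁻¹ (c i)) ∈ swapChoices n r (fun i => τ⁻¹ (x i)) ↔ c ∈ swapChoices n r x := by
  simp [swapChoices]

/-- The swapping subroutine is invariant under permutations of the domain and of
the range: `P(Swap(π; x) = σ) = P(Swap(π∘τ; τ⁻¹∘x) = σ∘τ)` and
`P(Swap(π; x) = σ) = P(Swap(τ∘π; x) = τ∘σ)`. -/
theorem swap_invariant (n : ℕ) (hn : 1 ≤ n) (r : ℕ)
    (π : Equiv.Perm (Fin n)) (x : Fin r → Fin n) (hx : Function.Injective x)
    (σ τ : Equiv.Perm (Fin n)) :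
    swapProb π x σ = swapProb (π * τ) (fun i => τ⁻¹ (x i)) (σ * τ) ∧
    swapProb π x σ = swapProb (τ * π) x (τ * σ) := by
  refine ⟨?_, ?_⟩
  · let e : (Fin r → Fin n) ≃ (Fin r → Fin n) := Equiv.piCongrRight fun _ => τ⁻¹
    have he (c : Fin r → Fin n) : e c = fun i => τ⁻¹ (c i) := rfl
    unfold swapProb
    congr 2
    · refine Finset.card_equiv e fun c => ?_
      rw [Finset.mem_filter, Finset.mem_filter, he, mem_swapChoices_comp_iff,
        swapResult_mul_right, mul_left_inj]
    · exact Finset.card_equiv e fun c => (mem_swapChoices_comp_iff τ x c).symm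
  · simp only [swapProb, swapResult_mul_left, mul_right_inj]
end

section
/- Let n ≥ 1, let π be a permutation of [n], let x_1, …, x_r ∈ [n] be distinct, and set y_i = π(x_i) for i = 1, …, r. Define the random permutation Swap2(π; y_1, …, y_r) = (Swap(π⁻¹; y_1, …, y_r))⁻¹. Then Swap and Swap2 induce the same distribution: for every permutation σ of [n], P(Swap(π; x_1, …, x_r) = σ) = P(Swap2(π; y_1, …, y_r) = σ). -/
open scoped Classical

theorem swapResult_eq_mul {n r : ℕ} (π : Equiv.Perm (Fin n)) (x c : Fin r → Fin n) :
    swapResult π x c = π * swapResult 1 x c := by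
  simp only [swapResult_eq_mul_prod, one_mul]

theorem swapResult_one_succ {n r : ℕ} (x c : Fin (r + 1) → Fin n) :
    swapResult 1 x c = Equiv.swap (x 0) (c 0) * swapResult 1 (Fin.tail x) (Fin.tail c) := by
  simp [swapResult_eq_mul_prod, List.ofFn_succ, Fin.tail]

theorem swapResult_one_apply_of_forall_ne {n r : ℕ} {x c : Fin r → Fin n} {a : Fin n}
    (hx : ∀ i, x i ≠ a) (hc : ∀ i, c i ≠ a) : swapResult 1 x c a = a := by
  induction r with
  | zero => simp [swapResult]
  | succ r ih =>
    rw [swapResult_one_succ, Equiv.Perm.mul_apply,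
      ih (x := Fin.tail x) (c := Fin.tail c) (fun i => hx i.succ) (fun i => hc i.succ),
      Equiv.swap_apply_of_ne_of_ne (hx 0).symm (hc 0).symm]

theorem mem_swapChoices {n r : ℕ} {x c : Fin r → Fin n} :
    c ∈ swapChoices n r x ↔ ∀ i j : Fin r, j < i → c i ≠ x j := by
  simp [swapChoices]

theorem mem_swapChoices_succ {n r : ℕ} {x c : Fin (r + 1) → Fin n} :
    c ∈ swapChoices n (r + 1) x ↔
      (∀ i, Fin.tail c i ≠ x 0) ∧ Fin.tail c ∈ swapChoices n r (Fin.tail x) := by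
  simp [mem_swapChoices, Fin.forall_fin_succ (n := r), Fin.tail, forall_and]

theorem tail_ne_head {n r : ℕ} {x : Fin (r + 1) → Fin n} (hx : Function.Injective x)
    (i : Fin r) : Fin.tail x i ≠ x 0 :=
  hx.ne (Fin.succ_ne_zero i)

theorem tail_injective {n r : ℕ} {x : Fin (r + 1) → Fin n} (hx : Function.Injective x) :
    Function.Injective (Fin.tail x) :=
  hx.comp (Fin.succ_injective r)

theorem swapResult_one_injOn {n r : ℕ} {x : Fin r → Fin n} (hx : Function.Injective x) :
    Set.InjOn (swapResult 1 x) (swapChoices n r x) := by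
  induction r with
  | zero => exact fun _ _ _ _ _ => Subsingleton.elim _ _
  | succ r ih =>
    intro c hc d hd h
    obtain ⟨hc₀, hc⟩ := mem_swapChoices_succ.1 hc
    obtain ⟨hd₀, hd⟩ := mem_swapChoices_succ.1 hd
    rw [swapResult_one_succ, swapResult_one_succ] at h
    have h₀ : c 0 = d 0 := by
      simpa [swapResult_one_apply_of_forall_ne (tail_ne_head hx) hc₀,
        swapResult_one_apply_of_forall_ne (tail_ne_head hx) hd₀] using
        DFunLike.congr_fun h (x 0)
    rw [h₀] at h
    have ht := ih (tail_injective hx) hc hd (mul_left_cancel h)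
    rw [← Fin.cons_self_tail c, ← Fin.cons_self_tail d, h₀, ht]

/-- The set of permutations that the subroutine can produce from the identity is closed under
inversion, without using points avoided by the original choices. -/
theorem exists_swapResult_one_eq_inv {n r : ℕ} {x c : Fin r → Fin n}
    (hx : Function.Injective x) (hc : c ∈ swapChoices n r x) :
    ∃ d ∈ swapChoices n r x, swapResult 1 x d = (swapResult 1 x c)⁻¹ ∧
      ∀ a, (∀ i, x i ≠ a) → (∀ i, c i ≠ a) → ∀ i, d i ≠ a := by
  induction r with
  | zero => exact ⟨c, hc, by simp [swapResult], fun _ _ h => h⟩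
  | succ r ih =>
    obtain ⟨hc₀, hc⟩ := mem_swapChoices_succ.1 hc
    obtain ⟨d, hd, hdinv, hda⟩ := ih (tail_injective hx) hc
    set ρ := swapResult 1 (Fin.tail x) (Fin.tail c) with hρ
    have hρ₀ : ρ (x 0) = x 0 := swapResult_one_apply_of_forall_ne (tail_ne_head hx) hc₀
    have hρ₀' : ρ⁻¹ (x 0) = x 0 := Equiv.Perm.inv_eq_iff_eq.2 hρ₀.symm
    refine ⟨Fin.cons (ρ⁻¹ (c 0)) d, ?_, ?_, ?_⟩
    · refine mem_swapChoices_succ.2 ⟨?_, ?_⟩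
      · simpa using hda (x 0) (tail_ne_head hx) hc₀
      · simpa using hd
    · rw [swapResult_one_succ, swapResult_one_succ, Fin.tail_cons, Fin.cons_zero, hdinv,
        mul_inv_rev, Equiv.swap_inv, ← hρ, Equiv.mul_swap_eq_swap_mul, hρ₀']
    · intro a hxa hca
      refine Fin.cases ?_ fun i => ?_
      · rw [Fin.cons_zero, ne_eq, Equiv.Perm.inv_eq_iff_eq, hρ,
          swapResult_one_apply_of_forall_ne (x := Fin.tail x) (c := Fin.tail c)
            (fun i => hxa i.succ) (fun i => hca i.succ)]
        exact hca 0
      · exact hda a (fun i => hxa i.succ) (fun i => hca i.succ) i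

theorem card_swapResult_one_eq_le_inv {n r : ℕ} {x : Fin r → Fin n}
    (hx : Function.Injective x) (τ : Equiv.Perm (Fin n)) :
    ((swapChoices n r x).filter fun c => swapResult 1 x c = τ).card ≤
      ((swapChoices n r x).filter fun c => swapResult 1 x c = τ⁻¹).card := by
  have hle : ((swapChoices n r x).filter fun c => swapResult 1 x c = τ).card ≤ 1 := by
    refine Finset.card_le_one.2 fun c hc d hd => ?_
    rw [Finset.mem_filter] at hc hd
    exact swapResult_one_injOn hx hc.1 hd.1 (hc.2.trans hd.2.symm)
  rcases Finset.eq_empty_or_nonempty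
    ((swapChoices n r x).filter fun c => swapResult 1 x c = τ) with h | ⟨c, hc⟩
  · simp [h]
  · rw [Finset.mem_filter] at hc
    obtain ⟨d, hd, hdinv, -⟩ := exists_swapResult_one_eq_inv hx hc.1
    exact hle.trans (Finset.card_pos.2 ⟨d, Finset.mem_filter.2 ⟨hd, hc.2 ▸ hdinv⟩⟩)

theorem card_swapResult_one_eq_inv {n r : ℕ} {x : Fin r → Fin n}
    (hx : Function.Injective x) (τ : Equiv.Perm (Fin n)) :
    ((swapChoices n r x).filter fun c => swapResult 1 x c = τ).card =
      ((swapChoices n r x).filter fun c => swapResult 1 x c = τ⁻¹).card :=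
  (card_swapResult_one_eq_le_inv hx τ).antisymm <| by
    simpa only [inv_inv] using card_swapResult_one_eq_le_inv hx τ⁻¹

theorem swapResult_one_conj {n r : ℕ} (π : Equiv.Perm (Fin n)) (x c : Fin r → Fin n) :
    swapResult 1 (fun i => π (x i)) (fun i => π (c i)) = π * swapResult 1 x c * π⁻¹ := by
  induction r with
  | zero => simp [swapResult]
  | succ r ih =>
    have h := ih (Fin.tail x) (Fin.tail c)
    rw [swapResult_one_succ, swapResult_one_succ x c, ← mul_assoc π, Equiv.mul_swap_eq_swap_mul,
      mul_assoc, mul_assoc, ← mul_assoc π, ← h]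
    rfl

theorem swapChoices_comp {n r : ℕ} (π : Equiv.Perm (Fin n)) (x : Fin r → Fin n) :
    swapChoices n r (fun i => π (x i)) =
      (swapChoices n r x).map (Equiv.arrowCongr (Equiv.refl (Fin r)) π).toEmbedding := by
  ext c
  rw [Finset.mem_map_equiv, mem_swapChoices, mem_swapChoices]
  simp [Equiv.symm_apply_eq]

/-- `Swap` and `Swap2` induce the same distribution, where
`Swap2(π; y_1, …, y_r) = (Swap(π⁻¹; y_1, …, y_r))⁻¹` and `y_i = π(x_i)`:
for every `σ`, `P(Swap(π; x_1, …, x_r) = σ) = P(Swap2(π; y_1, …, y_r) = σ)`.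
Note `P(Swap2(π; y) = σ) = P(Swap(π⁻¹; y) = σ⁻¹)`. -/
theorem swap_swap2_same_distribution (n : ℕ) (hn : 1 ≤ n) (r : ℕ)
    (π : Equiv.Perm (Fin n)) (x : Fin r → Fin n) (hx : Function.Injective x)
    (σ : Equiv.Perm (Fin n)) :
    swapProb π x σ = swapProb π⁻¹ (fun i => π (x i)) σ⁻¹ := by
  rw [swapProb, swapProb, swapChoices_comp, Finset.filter_map, Finset.card_map, Finset.card_map]
  congr 2
  have h₁ (c : Fin r → Fin n) : swapResult π x c = σ ↔ swapResult 1 x c = π⁻¹ * σ := by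
    rw [swapResult_eq_mul, eq_inv_mul_iff_mul_eq]
  have h₂ (c : Fin r → Fin n) :
      swapResult π⁻¹ (fun i => π (x i)) (fun i => π (c i)) = σ⁻¹ ↔
        swapResult 1 x c = (π⁻¹ * σ)⁻¹ := by
    rw [swapResult_eq_mul, swapResult_one_conj, mul_inv_rev, inv_inv, mul_assoc,
      inv_mul_cancel_left, mul_inv_eq_iff_eq_mul]
  rw [Finset.filter_congr fun c _ => h₁ c, card_swapResult_one_eq_inv hx]
  exact congrArg Finset.card (Finset.filter_congr fun c _ => (h₂ c).symm)
end
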